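/- arXiv:1504.07214 — 7 statements merged into one kernel-verified Lean document; each statement's English description precedes it below -/
import Mathlib

section
/- Let e_1,e_2,e_3,e_4,m_0,m_1,m_2,m_3 be complex numbers and set W(ζ)=ζ^4−e_1ζ^3+e_2ζ^2−e_3ζ+e_4 and 2V(ζ)=m_0ζ^3−m_1ζ^2+m_2ζ−m_3. Suppose f:ℝ→ℂ is differentiable and 2π-periodic, that W(e^{iθ})≠0 for all real θ, and that f satisfies the semi-classical equation f'(θ) = i e^{iθ}·(2V(e^{iθ})/W(e^{iθ}))·f(θ) for all θ. Define the Fourier coefficients w_p = (1/(2π))∫_{−π}^{π} f(θ) e^{−ipθ} dθ for p ∈ ℤ. Then for every p ∈ ℤ one has (p+1)e_4·w_{p+1} − (p·e_3 − m_3)·w_p + ((p−1)e_2 − m_2)·w_{p−1} − ((p−2)e_1 − m_1)·w_{p−2} + ((p−3) − m_0)·w_{p−3} = 0. -/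
open MeasureTheory

/-- The derivative of the Fourier character `θ ↦ exp (-ikθ)`. -/
theorem hasDerivAt_exp_neg_I_mul (k : ℂ) (θ : ℝ) :
    HasDerivAt (fun t : ℝ => Complex.exp (-Complex.I * k * (t:ℂ)))
      (-Complex.I * k * Complex.exp (-Complex.I * k * (θ:ℂ))) θ := by
  have h := ((Complex.ofRealCLM.hasDerivAt (x := θ)).const_mul (-Complex.I * k)).cexp
  simpa [mul_comm] using h

/-- Fourier characters of integer frequency agree at `-π` and `π`. -/
theorem exp_neg_I_mul_int_mul_neg_pi (k : ℤ) :
    Complex.exp (-Complex.I * (k:ℂ) * ((-Real.pi : ℝ):ℂ)) =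
      Complex.exp (-Complex.I * (k:ℂ) * ((Real.pi : ℝ):ℂ)) := by
  rw [Complex.exp_eq_exp_iff_exists_int]
  exact ⟨k, by push_cast; ring⟩

/-- The adapted moment recurrence for the Fourier coefficients of a regular
semi-classical weight on the unit circle whose logarithmic derivative is `2V/W`
with `W(ζ) = ζ^4 − e₁ζ³ + e₂ζ² − e₃ζ + e₄` and `2V(ζ) = m₀ζ³ − m₁ζ² + m₂ζ − m₃`. -/
theorem stmt0 (e1 e2 e3 e4 m0 m1 m2 m3 : ℂ) (W V2 : ℂ → ℂ)
    (hW : ∀ ζ : ℂ, W ζ = ζ^4 - e1*ζ^3 + e2*ζ^2 - e3*ζ + e4)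
    (hV : ∀ ζ : ℂ, V2 ζ = m0*ζ^3 - m1*ζ^2 + m2*ζ - m3)
    (f : ℝ → ℂ)
    (hdiff : Differentiable ℝ f)
    (hper : ∀ θ : ℝ, f (θ + 2*Real.pi) = f θ)
    (hWne : ∀ θ : ℝ, W (Complex.exp (Complex.I * (θ:ℂ))) ≠ 0)
    (hode : ∀ θ : ℝ, deriv f θ =
      Complex.I * Complex.exp (Complex.I * (θ:ℂ)) *
        (V2 (Complex.exp (Complex.I * (θ:ℂ))) / W (Complex.exp (Complex.I * (θ:ℂ)))) * f θ)
    (w : ℤ → ℂ)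
    (hw : ∀ p : ℤ, w p = (1/(2*(Real.pi:ℂ))) *
      ∫ θ in (-Real.pi)..Real.pi, f θ * Complex.exp (-Complex.I * (p:ℂ) * (θ:ℂ))) :
    ∀ p : ℤ,
      ((p:ℂ)+1) * e4 * w (p+1) - ((p:ℂ)*e3 - m3) * w p
        + (((p:ℂ)-1)*e2 - m2) * w (p-1) - (((p:ℂ)-2)*e1 - m1) * w (p-2)
        + (((p:ℂ)-3) - m0) * w (p-3) = 0 := by
  intro p
  let F : ℤ → ℝ → ℂ := fun k θ => f θ * Complex.exp (-Complex.I * (k:ℂ) * (θ:ℂ))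
  have hF_int : ∀ k : ℤ, IntervalIntegrable (F k) volume (-Real.pi) Real.pi := fun k =>
    (hdiff.continuous.mul (by fun_prop)).intervalIntegrable _ _
  let G : ℝ → ℂ := fun θ =>
    e4 * F (p+1) θ - e3 * F p θ + e2 * F (p-1) θ - e1 * F (p-2) θ + F (p-3) θ
  let S : ℝ → ℂ := fun θ =>
    ((p:ℂ)+1) * e4 * F (p+1) θ - ((p:ℂ)*e3 - m3) * F p θ
      + (((p:ℂ)-1)*e2 - m2) * F (p-1) θ - (((p:ℂ)-2)*e1 - m1) * F (p-2) θ
      + (((p:ℂ)-3) - m0) * F (p-3) θ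
  have hF_deriv : ∀ (k : ℤ) (θ : ℝ), HasDerivAt (F k)
      (deriv f θ * Complex.exp (-Complex.I * (k:ℂ) * (θ:ℂ)) +
        f θ * (-Complex.I * k * Complex.exp (-Complex.I * (k:ℂ) * (θ:ℂ)))) θ := fun k θ =>
    (hdiff θ).hasDerivAt.mul (hasDerivAt_exp_neg_I_mul k θ)
  have hG_deriv : ∀ θ : ℝ, HasDerivAt G (-Complex.I * S θ) θ := by
    intro θ
    have h := (((((hF_deriv (p+1) θ).const_mul e4).sub ((hF_deriv p θ).const_mul e3)).add
      ((hF_deriv (p-1) θ).const_mul e2)).sub ((hF_deriv (p-2) θ).const_mul e1)).add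
      (hF_deriv (p-3) θ)
    refine h.congr_deriv ?_
    have hode' : deriv f θ * W (Complex.exp (Complex.I * (θ:ℂ))) =
        Complex.I * Complex.exp (Complex.I * (θ:ℂ)) *
          V2 (Complex.exp (Complex.I * (θ:ℂ))) * f θ := by
      rw [hode θ]
      field_simp [hWne θ]
    rw [hW, hV] at hode'
    set z := Complex.exp (Complex.I * (θ:ℂ)) with hz
    set x := Complex.exp (-Complex.I * ((p+1 : ℤ):ℂ) * (θ:ℂ)) with hx
    have h0 : Complex.exp (-Complex.I * (p:ℂ) * (θ:ℂ)) = x * z := by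
      rw [hx, hz, ← Complex.exp_add]; congr 1; push_cast; ring
    have hshift : ∀ n : ℕ, Complex.exp (-Complex.I * ((p-n : ℤ):ℂ) * (θ:ℂ)) = x * z ^ (n+1) := by
      intro n
      rw [hx, hz, ← Complex.exp_nat_mul, ← Complex.exp_add]; congr 1; push_cast; ring
    have h1 := hshift 1
    have h2 := hshift 2
    have h3 := hshift 3
    norm_num only [Nat.cast_one, Nat.cast_ofNat] at h1 h2 h3
    simp only [S, F]
    rw [← hx, h0, h1, h2, h3]
    push_cast
    linear_combination x * hode'
  have hS_int : IntervalIntegrable S volume (-Real.pi) Real.pi :=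
    (((((hF_int (p+1)).const_mul _).sub ((hF_int p).const_mul _)).add
      ((hF_int (p-1)).const_mul _)).sub ((hF_int (p-2)).const_mul _)).add
      ((hF_int (p-3)).const_mul _)
  have hf_pi : f (-Real.pi) = f Real.pi := by
    rw [← hper (-Real.pi)]; congr 1; ring
  have hF_pi : ∀ k : ℤ, F k (-Real.pi) = F k Real.pi := fun k => by
    simp only [F]
    rw [hf_pi, exp_neg_I_mul_int_mul_neg_pi]
  have hS_zero : ∫ θ in (-Real.pi)..Real.pi, S θ = 0 := by
    have h := intervalIntegral.integral_eq_sub_of_hasDerivAt (a := -Real.pi) (b := Real.pi)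
      (fun θ _ => hG_deriv θ) (hS_int.const_mul _)
    rw [intervalIntegral.integral_const_mul] at h
    simpa [G, hF_pi] using h
  have hS_sum := hS_zero
  simp only [S] at hS_sum
  rw [intervalIntegral.integral_add
      (((((hF_int (p+1)).const_mul _).sub ((hF_int p).const_mul _)).add
        ((hF_int (p-1)).const_mul _)).sub ((hF_int (p-2)).const_mul _))
      ((hF_int (p-3)).const_mul _),
    intervalIntegral.integral_sub
      ((((hF_int (p+1)).const_mul _).sub ((hF_int p).const_mul _)).add
        ((hF_int (p-1)).const_mul _)) ((hF_int (p-2)).const_mul _),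
    intervalIntegral.integral_add
      (((hF_int (p+1)).const_mul _).sub ((hF_int p).const_mul _)) ((hF_int (p-1)).const_mul _),
    intervalIntegral.integral_sub ((hF_int (p+1)).const_mul _) ((hF_int p).const_mul _)]
    at hS_sum
  simp only [intervalIntegral.integral_const_mul] at hS_sum
  have hw' : ∀ k : ℤ, w k = (1/(2*(Real.pi:ℂ))) * ∫ θ in (-Real.pi)..Real.pi, F k θ := hw
  simp only [hw']
  linear_combination (1/(2*(Real.pi:ℂ))) * hS_sum
end

section
/- For all n ∈ ℤ the Toeplitz matrix elements w_n of the diagonal correlations of the anisotropic triangular Ising model satisfy the fourth-order linear homogeneous recurrence (n−3)·v_1²v_2²(1−v_3²)²·w_{n−3} − 2v_1v_2Γ·(v_3+(n−2)(1+v_3²))·w_{n−2} + [ (n−1)(v_1⁴+4v_1²v_2²+v_2⁴)v_3⁴ − 2(n−1)(v_1²+v_2²−6v_1²v_2²+v_1⁴v_2²+v_1²v_2⁴)v_3² + (n−1)(1+4v_1²v_2²+v_1⁴v_2⁴) + 8v_1²v_2²v_3(1+v_3²) ]·w_{n−1} − 2v_1v_2Γ·(v_3+n(1+v_3²))·w_n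 + (n+1)·v_1²v_2²(1−v_3²)²·w_{n+1} = 0. -/
open MeasureTheory

open Real in
/-- The numerator of the integrand defining the Toeplitz matrix elements. -/
noncomputable def toeplitzNumerator (a b c x θ : ℝ) : ℝ :=
  a * cos (x * θ) - b * cos ((x - 1) * θ) - c * cos ((x + 1) * θ)

open Real in
/-- The squared modulus of `a - b * exp (i * θ) - c * exp (-i * θ)`. -/
noncomputable def symbolNormSq (a b c θ : ℝ) : ℝ :=
  a ^ 2 + b ^ 2 + c ^ 2 - 2 * a * (b + c) * cos θ + 2 * b * c * cos (2 * θ)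

open Real in
/-- The numerator conjugate to `toeplitzNumerator`, with sines in place of cosines. -/
noncomputable def toeplitzConjNumerator (a b c x θ : ℝ) : ℝ :=
  a * sin (x * θ) - b * sin ((x - 1) * θ) - c * sin ((x + 1) * θ)

open Real in
lemma hasDerivAt_symbolNormSq (a b c θ : ℝ) :
    HasDerivAt (symbolNormSq a b c)
      (2 * a * (b + c) * sin θ - 4 * b * c * sin (2 * θ)) θ := by
  have h2 : HasDerivAt (fun t : ℝ => cos (2 * t)) (-sin (2 * θ) * (2 * 1)) θ :=
    ((hasDerivAt_id θ).const_mul 2).cos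
  have h := (((hasDerivAt_cos θ).const_mul (2 * a * (b + c))).const_sub
    (a ^ 2 + b ^ 2 + c ^ 2)).add (h2.const_mul (2 * b * c))
  exact h.congr_deriv (by ring)

open Real in
lemma hasDerivAt_toeplitzConjNumerator (a b c x θ : ℝ) :
    HasDerivAt (toeplitzConjNumerator a b c x)
      (a * x * cos (x * θ) - b * (x - 1) * cos ((x - 1) * θ)
        - c * (x + 1) * cos ((x + 1) * θ)) θ := by
  have h (y : ℝ) : HasDerivAt (fun t : ℝ => sin (y * t)) (cos (y * θ) * (y * 1)) θ :=
    ((hasDerivAt_id θ).const_mul y).sin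
  have h' := (((h x).const_mul a).sub ((h (x - 1)).const_mul b)).sub ((h (x + 1)).const_mul c)
  exact h'.congr_deriv (by ring)

open Real in
/-- The trigonometric identity behind the recurrence: its right-hand side is the numerator of the
derivative of `√(symbolNormSq a b c) * toeplitzConjNumerator a b c x`. -/
lemma toeplitzNumerator_combination (a b c x θ : ℝ) :
    (x - 2) * (b * c) * toeplitzNumerator a b c (x - 2) θ
      - a * ((x - 1) * (b + c) + (c - b) / 2) * toeplitzNumerator a b c (x - 1) θ
      + (x * (a ^ 2 + b ^ 2 + c ^ 2) + c ^ 2 - b ^ 2) * toeplitzNumerator a b c x θ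
      - a * ((x + 1) * (b + c) + (c - b) / 2) * toeplitzNumerator a b c (x + 1) θ
      + (x + 2) * (b * c) * toeplitzNumerator a b c (x + 2) θ =
    (2 * a * (b + c) * sin θ - 4 * b * c * sin (2 * θ)) / 2 * toeplitzConjNumerator a b c x θ
      + symbolNormSq a b c θ * (a * x * cos (x * θ) - b * (x - 1) * cos ((x - 1) * θ)
        - c * (x + 1) * cos ((x + 1) * θ)) := by
  have hs3 : sin (3 * θ) = sin θ * (4 * cos θ ^ 2 - 1) := by
    rw [sin_three_mul]
    linear_combination (-4 * sin θ) * sin_sq_add_cos_sq θ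
  unfold toeplitzNumerator toeplitzConjNumerator symbolNormSq
  rw [show (x - 2 - 1) * θ = x * θ - 3 * θ by ring, show (x - 2 + 1) * θ = x * θ - θ by ring,
    show (x - 1 - 1) * θ = x * θ - 2 * θ by ring, show (x - 1 + 1) * θ = x * θ by ring,
    show (x + 1 - 1) * θ = x * θ by ring, show (x + 1 + 1) * θ = x * θ + 2 * θ by ring,
    show (x + 2 - 1) * θ = x * θ + θ by ring, show (x + 2 + 1) * θ = x * θ + 3 * θ by ring,
    show (x - 2) * θ = x * θ - 2 * θ by ring, show (x - 1) * θ = x * θ - θ by ring,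
    show (x + 1) * θ = x * θ + θ by ring, show (x + 2) * θ = x * θ + 2 * θ by ring]
  simp only [cos_add, cos_sub, sin_add, sin_sub, hs3, cos_three_mul, sin_two_mul, cos_two_mul]
  linear_combination
    (-(a * (b + c) - 4 * b * c * cos θ) * (b - c) * cos (x * θ)) * sin_sq_add_cos_sq θ

open Real in
lemma toeplitzConjNumerator_pi (a b c : ℝ) (m : ℤ) : toeplitzConjNumerator a b c m π = 0 := by
  have h1 := sin_int_mul_pi m
  have h2 := sin_int_mul_pi (m - 1)
  have h3 := sin_int_mul_pi (m + 1)
  push_cast at h2 h3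
  simp [toeplitzConjNumerator, h1, h2, h3]

lemma toeplitzConjNumerator_neg (a b c x θ : ℝ) :
    toeplitzConjNumerator a b c x (-θ) = -toeplitzConjNumerator a b c x θ := by
  simp only [toeplitzConjNumerator, mul_neg, Real.sin_neg]
  ring

open Real in
/-- The recurrence satisfied by the integrals, in terms of the coefficients of the symbol. -/
lemma toeplitz_integral_recurrence (a b c : ℝ) (hR : ∀ θ, 0 < symbolNormSq a b c θ)
    (I : ℝ → ℝ)
    (hI : ∀ x, I x = ∫ θ in (-π)..π, toeplitzNumerator a b c x θ / √(symbolNormSq a b c θ))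
    (m : ℤ) :
    ((m : ℝ) - 2) * (b * c) * I (m - 2)
      - a * (((m : ℝ) - 1) * (b + c) + (c - b) / 2) * I (m - 1)
      + (m * (a ^ 2 + b ^ 2 + c ^ 2) + c ^ 2 - b ^ 2) * I m
      - a * (((m : ℝ) + 1) * (b + c) + (c - b) / 2) * I (m + 1)
      + ((m : ℝ) + 2) * (b * c) * I (m + 2) = 0 := by
  have hcont (x : ℝ) :
      Continuous fun θ => toeplitzNumerator a b c x θ / √(symbolNormSq a b c θ) := by
    refine Continuous.div ?_ ?_ fun θ => (sqrt_pos.2 (hR θ)).ne'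
    · unfold toeplitzNumerator; fun_prop
    · unfold symbolNormSq; fun_prop
  have hint (k x : ℝ) : IntervalIntegrable
      (fun θ => k * (toeplitzNumerator a b c x θ / √(symbolNormSq a b c θ))) volume (-π) π :=
    ((hcont x).const_mul k).intervalIntegrable _ _
  have hderiv (θ : ℝ) := (hasDerivAt_symbolNormSq a b c θ).sqrt (hR θ).ne' |>.mul
    (hasDerivAt_toeplitzConjNumerator a b c m θ)
  simp only [hI, ← intervalIntegral.integral_const_mul]
  rw [← intervalIntegral.integral_sub (hint _ _) (hint _ _),
    ← intervalIntegral.integral_add ((hint _ _).sub (hint _ _)) (hint _ _),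
    ← intervalIntegral.integral_sub (((hint _ _).sub (hint _ _)).add (hint _ _)) (hint _ _),
    ← intervalIntegral.integral_add
      ((((hint _ _).sub (hint _ _)).add (hint _ _)).sub (hint _ _)) (hint _ _),
    intervalIntegral.integral_eq_sub_of_hasDerivAt
      (fun θ _ => (hderiv θ).congr_deriv ?_)
      (((((hint _ _).sub (hint _ _)).add (hint _ _)).sub (hint _ _)).add (hint _ _))]
  · simp [toeplitzConjNumerator_neg, toeplitzConjNumerator_pi]
  · have hs : √(symbolNormSq a b c θ) ≠ 0 := (sqrt_pos.2 (hR θ)).ne'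
    have hsq : √(symbolNormSq a b c θ) ^ 2 = symbolNormSq a b c θ := sq_sqrt (hR θ).le
    have key := toeplitzNumerator_combination a b c m θ
    field_simp
    simp only [hsq, mul_comm θ]
    linear_combination -2 * key

/-- The fourth-order linear homogeneous recurrence satisfied by the Toeplitz matrix
elements of the diagonal correlations of the anisotropic triangular Ising model. -/
theorem stmt1 (v1 v2 v3 : ℝ) (hv1 : 0 < v1) (hv2 : 0 < v2) (hv3 : 0 < v3) (hv3' : v3 ≠ 1)
    (z1 z2 z3 a b c Γ : ℝ)
    (hz1 : z1 = (1-v1)/(1+v1)) (hz2 : z2 = (1-v2)/(1+v2)) (hz3 : z3 = (1-v3)/(1+v3))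
    (ha : a = 2*z3*(1+z1^2)*(1+z2^2) + 4*z1*z2*(1+z3^2))
    (hc : c = (1-z1^2)*(1-z2^2))
    (hb : b = z3^2*c)
    (hΓ : Γ = 1 + v1^2*v2^2 - (v1^2+v2^2)*v3^2)
    (hR : ∀ θ : ℝ,
      0 < a^2 + b^2 + c^2 - 2*a*(b+c)*Real.cos θ + 2*b*c*Real.cos (2*θ))
    (w : ℤ → ℝ)
    (hw : ∀ n : ℤ, w n = (1/(2*Real.pi)) *
      ∫ θ in (-Real.pi)..Real.pi,
        (a * Real.cos ((n:ℝ)*θ) - b * Real.cos (((n:ℝ)-1)*θ) - c * Real.cos (((n:ℝ)+1)*θ)) /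
          Real.sqrt (a^2 + b^2 + c^2 - 2*a*(b+c)*Real.cos θ + 2*b*c*Real.cos (2*θ))) :
    ∀ n : ℤ,
      ((n:ℝ)-3) * v1^2*v2^2*(1-v3^2)^2 * w (n-3)
      - 2*v1*v2*Γ*(v3 + ((n:ℝ)-2)*(1+v3^2)) * w (n-2)
      + ( ((n:ℝ)-1)*(v1^4 + 4*v1^2*v2^2 + v2^4)*v3^4
          - 2*((n:ℝ)-1)*(v1^2 + v2^2 - 6*v1^2*v2^2 + v1^4*v2^2 + v1^2*v2^4)*v3^2
          + ((n:ℝ)-1)*(1 + 4*v1^2*v2^2 + v1^4*v2^4)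
          + 8*v1^2*v2^2*v3*(1+v3^2) ) * w (n-1)
      - 2*v1*v2*Γ*(v3 + (n:ℝ)*(1+v3^2)) * w n
      + ((n:ℝ)+1) * v1^2*v2^2*(1-v3^2)^2 * w (n+1) = 0 := by
  have h1 : 1 + v1 ≠ 0 := by positivity
  have h2 : 1 + v2 ≠ 0 := by positivity
  have h3 : 1 + v3 ≠ 0 := by positivity
  obtain ⟨κ, hκ⟩ : ∃ κ : ℝ, κ = 16 / ((1 + v1) * (1 + v2) * (1 + v3)) ^ 2 := ⟨_, rfl⟩
  have hκ0 : κ ≠ 0 := by rw [hκ]; positivity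
  have ha' : a = κ * Γ := by
    rw [ha, hκ, hΓ, hz1, hz2, hz3]; field_simp; ring
  have hc' : c = κ * (v1 * v2 * (1 + v3) ^ 2) := by
    rw [hc, hκ, hz1, hz2]; field_simp; ring
  have hb' : b = κ * (v1 * v2 * (1 - v3) ^ 2) := by
    rw [hb, hc', hz3]; field_simp
  intro n
  obtain ⟨I, hI⟩ : ∃ I : ℝ → ℝ, ∀ x, I x = ∫ θ in (-Real.pi)..Real.pi,
      toeplitzNumerator a b c x θ / √(symbolNormSq a b c θ) := ⟨_, fun _ => rfl⟩
  have hwI (k : ℤ) : w k = 1 / (2 * Real.pi) * I k := by rw [hw, hI]; rfl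
  have key := toeplitz_integral_recurrence a b c hR I hI (n - 1)
  push_cast at key
  rw [show (n : ℝ) - 1 - 2 = n - 3 by ring, show (n : ℝ) - 1 - 1 = n - 2 by ring,
    show (n : ℝ) - 1 + 1 = n by ring, show (n : ℝ) - 1 + 2 = n + 1 by ring] at key
  simp only [hwI]
  push_cast
  refine (mul_eq_zero.1 ?_).resolve_left (pow_ne_zero 2 hκ0)
  rw [ha', hb', hc', hΓ] at key
  rw [hΓ]
  linear_combination 1 / (2 * Real.pi) * key
end

section
/- For all n ∈ ℤ the Toeplitz matrix elements w_n of the column correlations of the anisotropic square-lattice Ising model satisfy the fourth-order linear homogeneous recurrence 2α_1α_2(n−3)·w_{n−3} − (1+α_1α_2)·((2n−5)α_1+(2n−3)α_2)·w_{n−2} + 2·((n−2)α_1²+nα_2²+(n−1)(1+α_1α_2)²)·w_{n−1} − (1+α_1α_2)·((2n−1)α_1+(2n+1)α_2)·w_n + 2α_1α_2(n+1)·w_{n+1} = 0. -/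
open MeasureTheory

/-- The quadratic `1 - 2 a cos θ + a²` is positive unless `a = ±1`. -/
lemma one_sub_two_mul_cos_add_sq_pos {a : ℝ} (h1 : a ≠ 1) (h2 : a ≠ -1) (θ : ℝ) :
    0 < 1 - 2*a*Real.cos θ + a^2 := by
  have hp : 0 < (1 - a)^2 := by have := sub_ne_zero.2 h1.symm; positivity
  have hq : 0 < (1 + a)^2 := by
    have : 1 + a ≠ 0 := fun h ↦ h2 (by linarith)
    positivity
  have hl := sub_nonneg.2 (Real.neg_one_le_cos θ)
  have hu := sub_nonneg.2 (Real.cos_le_one θ)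
  rcases le_total 0 (Real.cos θ) with hc | hc
  · nlinarith [mul_nonneg hu hq.le, mul_nonneg hc hp.le]
  · nlinarith [mul_nonneg hl hp.le, mul_nonneg (neg_nonneg.2 hc) hq.le]

/-- The numerator of the integrand of a Toeplitz element, with `c, s` the cosine and sine of the
integration variable and `C, S` those of its multiple. -/
def toeplitzNum (a b c s C S : ℝ) : ℝ :=
  (1 + a*b - (a+b)*c) * C - (a-b) * s * S

/-- The combination of numerators in the recurrence is a derivative, up to the square root. -/
lemma toeplitzNum_recurrence (a b m c s C S : ℝ) (h : s^2 + c^2 = 1) :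
    2*a*b*(m-2) * toeplitzNum a b c s
        (C*(c^2-s^2) + S*(2*s*c)) (S*(c^2-s^2) - C*(2*s*c))
      - (1+a*b)*((2*m-3)*a+(2*m-1)*b) * toeplitzNum a b c s (C*c+S*s) (S*c-C*s)
      + 2*((m-1)*a^2+(m+1)*b^2+m*(1+a*b)^2) * toeplitzNum a b c s C S
      - (1+a*b)*((2*m+1)*a+(2*m+3)*b) * toeplitzNum a b c s (C*c-S*s) (S*c+C*s)
      + 2*a*b*(m+2) * toeplitzNum a b c s
        (C*(c^2-s^2) - S*(2*s*c)) (S*(c^2-s^2) + C*(2*s*c))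
    = (2*a*s*(1-2*b*c+b^2) + (1-2*a*c+a^2)*(2*b*s)) *
        ((1+a*b-(a+b)*c)*S + (a-b)*s*C)
      + 2*((1-2*a*c+a^2)*(1-2*b*c+b^2)) *
        ((a+b)*s*S + (1+a*b-(a+b)*c)*(C*m) + ((a-b)*c*C + (a-b)*s*(-S*m))) := by
  have h2 : s^2 = 1 - c^2 := by linarith
  have h3 : s^3 = s*(1 - c^2) := by rw [← h2]; ring
  unfold toeplitzNum
  ring_nf
  simp only [h2, h3]
  ring

/-- The fourth-order linear homogeneous recurrence satisfied by the Toeplitz matrix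
elements of the column correlations of the anisotropic square-lattice Ising model. -/
theorem stmt2 (α1 α2 : ℝ) (hα1 : α1 ≠ 1) (hα1' : α1 ≠ -1) (hα2 : α2 ≠ 1) (hα2' : α2 ≠ -1)
    (w : ℤ → ℝ)
    (hw : ∀ n : ℤ, w n = (1/(2*Real.pi)) *
      ∫ θ in (-Real.pi)..Real.pi,
        ((1 + α1*α2 - (α1+α2)*Real.cos θ) * Real.cos ((n:ℝ)*θ)
          - (α1-α2) * Real.sin θ * Real.sin ((n:ℝ)*θ)) /
        Real.sqrt ((1 - 2*α1*Real.cos θ + α1^2) * (1 - 2*α2*Real.cos θ + α2^2))) :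
    ∀ n : ℤ,
      2*α1*α2*((n:ℝ)-3) * w (n-3)
      - (1+α1*α2) * ((2*(n:ℝ)-5)*α1 + (2*(n:ℝ)-3)*α2) * w (n-2)
      + 2*(((n:ℝ)-2)*α1^2 + (n:ℝ)*α2^2 + ((n:ℝ)-1)*(1+α1*α2)^2) * w (n-1)
      - (1+α1*α2) * ((2*(n:ℝ)-1)*α1 + (2*(n:ℝ)+1)*α2) * w n
      + 2*α1*α2*((n:ℝ)+1) * w (n+1) = 0 := by
  intro n
  set D : ℝ → ℝ := fun θ ↦
    (1 - 2*α1*Real.cos θ + α1^2) * (1 - 2*α2*Real.cos θ + α2^2) with hD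
  have hDpos : ∀ θ, 0 < D θ := fun θ ↦ mul_pos (one_sub_two_mul_cos_add_sq_pos hα1 hα1' θ)
    (one_sub_two_mul_cos_add_sq_pos hα2 hα2' θ)
  have hDne : ∀ θ, Real.sqrt (D θ) ≠ 0 := fun θ ↦ (Real.sqrt_pos.2 (hDpos θ)).ne'
  have hDcont : Continuous D := by fun_prop
  set f : ℤ → ℝ → ℝ := fun k θ ↦
    toeplitzNum α1 α2 (Real.cos θ) (Real.sin θ) (Real.cos ((k:ℝ)*θ)) (Real.sin ((k:ℝ)*θ)) /
      Real.sqrt (D θ) with hf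
  have hfcont : ∀ k, Continuous (f k) := by
    intro k
    refine Continuous.div ?_ hDcont.sqrt hDne
    unfold toeplitzNum
    fun_prop
  have hfint : ∀ k (r : ℝ), IntervalIntegrable (fun θ ↦ r * f k θ) volume (-Real.pi) Real.pi :=
    fun k r ↦ (continuous_const.mul (hfcont k)).intervalIntegrable _ _
  have hw' : ∀ k, w k = (1/(2*Real.pi)) * ∫ θ in (-Real.pi)..Real.pi, f k θ := hw
  set G : ℝ → ℝ := fun θ ↦ 2 * (Real.sqrt (D θ) *
    ((1 + α1*α2 - (α1+α2)*Real.cos θ) * Real.sin (((n:ℝ)-1)*θ)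
      + (α1-α2) * Real.sin θ * Real.cos (((n:ℝ)-1)*θ))) with hG
  set g : ℝ → ℝ := fun θ ↦ 2*α1*α2*((n:ℝ)-3) * f (n-3) θ
      - (1+α1*α2) * ((2*(n:ℝ)-5)*α1 + (2*(n:ℝ)-3)*α2) * f (n-2) θ
      + 2*(((n:ℝ)-2)*α1^2 + (n:ℝ)*α2^2 + ((n:ℝ)-1)*(1+α1*α2)^2) * f (n-1) θ
      - (1+α1*α2) * ((2*(n:ℝ)-1)*α1 + (2*(n:ℝ)+1)*α2) * f n θ
      + 2*α1*α2*((n:ℝ)+1) * f (n+1) θ with hg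
  have hgcont : Continuous g := by fun_prop
  have hderiv : ∀ θ, HasDerivAt G (g θ) θ := by
    intro θ
    have hc := Real.hasDerivAt_cos θ
    have hs := Real.hasDerivAt_sin θ
    have hm : HasDerivAt (fun x : ℝ ↦ ((n:ℝ)-1)*x) ((n:ℝ)-1) θ := by
      simpa using (hasDerivAt_id θ).const_mul ((n:ℝ)-1)
    have hquad : ∀ a : ℝ, HasDerivAt (fun x ↦ 1 - 2*a*Real.cos x + a^2)
        (2*a*Real.sin θ) θ := fun a ↦ by
      simpa using ((hc.const_mul (2*a)).const_sub 1).add_const (a^2)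
    have hsqrt := ((hquad α1).mul (hquad α2)).sqrt (hDpos θ).ne'
    have hA : HasDerivAt (fun x ↦ 1 + α1*α2 - (α1+α2)*Real.cos x)
        ((α1+α2)*Real.sin θ) θ := by
      simpa using (hc.const_mul (α1+α2)).const_sub (1 + α1*α2)
    have hB := hs.const_mul (α1-α2)
    have key := (hsqrt.mul ((hA.mul hm.sin).add (hB.mul hm.cos))).const_mul 2
    refine key.congr_deriv ?_
    have hrec := toeplitzNum_recurrence α1 α2 ((n:ℝ)-1) (Real.cos θ) (Real.sin θ)
      (Real.cos (((n:ℝ)-1)*θ)) (Real.sin (((n:ℝ)-1)*θ)) (Real.sin_sq_add_cos_sq θ)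
    have hsq : Real.sqrt (D θ) * Real.sqrt (D θ) = D θ := Real.mul_self_sqrt (hDpos θ).le
    have e3 : (((n-3 : ℤ):ℝ))*θ = ((n:ℝ)-1)*θ - 2*θ := by push_cast; ring
    have e2 : (((n-2 : ℤ):ℝ))*θ = ((n:ℝ)-1)*θ - θ := by push_cast; ring
    have e1 : (((n-1 : ℤ):ℝ))*θ = ((n:ℝ)-1)*θ := by push_cast; ring
    have e0 : (n:ℝ)*θ = ((n:ℝ)-1)*θ + θ := by ring
    have e4 : (((n+1 : ℤ):ℝ))*θ = ((n:ℝ)-1)*θ + 2*θ := by push_cast; ring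
    simp only [hg, hf]
    rw [e3, e2, e1, e0, e4]
    simp only [Real.cos_add, Real.sin_add, Real.cos_sub, Real.sin_sub, Real.cos_two_mul',
      Real.sin_two_mul]
    have hR := hDne θ
    simp only [Pi.mul_apply, Pi.add_apply]
    change 2 * (_ / (2 * Real.sqrt (D θ)) * _ + Real.sqrt (D θ) * _) = _
    set R := Real.sqrt (D θ)
    have hsq' : R^2 = D θ := by rw [sq, hsq]
    field_simp
    rw [hsq']
    simp only [hD, toeplitzNum] at hrec ⊢
    linear_combination -hrec
  have hint : ∫ θ in (-Real.pi)..Real.pi, g θ = 0 := by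
    rw [intervalIntegral.integral_eq_sub_of_hasDerivAt (fun θ _ ↦ hderiv θ)
      (hgcont.intervalIntegrable _ _)]
    have hsin : Real.sin (((n:ℝ)-1)*Real.pi) = 0 := by
      simpa using Real.sin_int_mul_pi (n-1)
    simp [hG, hsin]
  have hlin : ∫ θ in (-Real.pi)..Real.pi, g θ =
      2*α1*α2*((n:ℝ)-3) * (∫ θ in (-Real.pi)..Real.pi, f (n-3) θ)
      - (1+α1*α2) * ((2*(n:ℝ)-5)*α1 + (2*(n:ℝ)-3)*α2) * (∫ θ in (-Real.pi)..Real.pi, f (n-2) θ)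
      + 2*(((n:ℝ)-2)*α1^2 + (n:ℝ)*α2^2 + ((n:ℝ)-1)*(1+α1*α2)^2)
        * (∫ θ in (-Real.pi)..Real.pi, f (n-1) θ)
      - (1+α1*α2) * ((2*(n:ℝ)-1)*α1 + (2*(n:ℝ)+1)*α2) * (∫ θ in (-Real.pi)..Real.pi, f n θ)
      + 2*α1*α2*((n:ℝ)+1) * (∫ θ in (-Real.pi)..Real.pi, f (n+1) θ) := by
    simp only [hg]
    rw [intervalIntegral.integral_add ((((hfint _ _).sub (hfint _ _)).add (hfint _ _)).sub
        (hfint _ _)) (hfint _ _),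
      intervalIntegral.integral_sub (((hfint _ _).sub (hfint _ _)).add (hfint _ _)) (hfint _ _),
      intervalIntegral.integral_add ((hfint _ _).sub (hfint _ _)) (hfint _ _),
      intervalIntegral.integral_sub (hfint _ _) (hfint _ _)]
    simp only [intervalIntegral.integral_const_mul]
  rw [hint] at hlin
  simp only [hw']
  linear_combination (-(1/(2*Real.pi))) * hlin
end

section
/- With the singularities ζ_1,ζ_2,ζ_3,ζ_4 defined from (v_1,v_2,v_3) as below, the numerator and denominator quadratics of the squared triangular-lattice weight factor as b·ζ² − a·ζ + c = b·(ζ−ζ_1)(ζ−ζ_2) and c·ζ² − a·ζ + b = c·(ζ−ζ_3)(ζ−ζ_4), as identities of polynomials in ζ; i.e. ζ_1+ζ_2 = a/b, ζ_1ζ_2 = c/b, ζ_3+ζ_4 = a/c and ζ_3ζ_4 = b/c. -/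
/-- A quadratic whose coefficients satisfy Vieta's relations splits with the given roots. -/
theorem quadratic_eq_of_vieta {K : Type*} [Field K] {p q r x y : K} (hp : p ≠ 0)
    (hsum : x + y = q / p) (hprod : x * y = r / p) (ζ : K) :
    p * ζ ^ 2 - q * ζ + r = p * (ζ - x) * (ζ - y) := by
  have hs : p * (x + y) = q := by rw [hsum]; field_simp
  have hm : p * (x * y) = r := by rw [hprod]; field_simp
  linear_combination ζ * hs - hm


/-- Factorisation of the numerator and denominator quadratics of the squared
triangular-lattice weight in terms of the singularities `ζ₁,ζ₂,ζ₃,ζ₄`. -/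
theorem stmt7 (v1 v2 v3 : ℝ) (hv1 : 0 < v1) (hv2 : 0 < v2) (hv3 : 0 < v3) (hv3' : v3 ≠ 1)
    (z1 z2 z3 a b c Γreal : ℝ)
    (hz1 : z1 = (1-v1)/(1+v1)) (hz2 : z2 = (1-v2)/(1+v2)) (hz3 : z3 = (1-v3)/(1+v3))
    (ha : a = 2*z3*(1+z1^2)*(1+z2^2) + 4*z1*z2*(1+z3^2))
    (hc : c = (1-z1^2)*(1-z2^2))
    (hb : b = z3^2*c)
    (hΓ : Γreal = 1 + v1^2*v2^2 - (v1^2+v2^2)*v3^2)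
    (Δ : ℂ)
    (hΔ : Δ^2 = ((1+v1*v2-v1*v3-v2*v3) * (1-v1*v2-v1*v3+v2*v3)
      * (1-v1*v2+v1*v3-v2*v3) * (1+v1*v2+v1*v3+v2*v3) : ℝ))
    (ζ1 ζ2 ζ3 ζ4 : ℂ)
    (hζ1 : ζ1 = ((Γreal:ℂ)+Δ)/(2*v1*v2*(1-v3)^2))
    (hζ2 : ζ2 = ((Γreal:ℂ)-Δ)/(2*v1*v2*(1-v3)^2))
    (hζ3 : ζ3 = ((Γreal:ℂ)+Δ)/(2*v1*v2*(1+v3)^2))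
    (hζ4 : ζ4 = ((Γreal:ℂ)-Δ)/(2*v1*v2*(1+v3)^2)) :
    (∀ ζ : ℂ, (b:ℂ)*ζ^2 - (a:ℂ)*ζ + (c:ℂ) = (b:ℂ)*(ζ-ζ1)*(ζ-ζ2)) ∧
    (∀ ζ : ℂ, (c:ℂ)*ζ^2 - (a:ℂ)*ζ + (b:ℂ) = (c:ℂ)*(ζ-ζ3)*(ζ-ζ4)) ∧
    ζ1 + ζ2 = (a:ℂ)/(b:ℂ) ∧ ζ1 * ζ2 = (c:ℂ)/(b:ℂ) ∧
    ζ3 + ζ4 = (a:ℂ)/(c:ℂ) ∧ ζ3 * ζ4 = (b:ℂ)/(c:ℂ) := by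
  have h1 : 1 + v1 ≠ 0 := by positivity
  have h2 : 1 + v2 ≠ 0 := by positivity
  have h3 : 1 + v3 ≠ 0 := by positivity
  have h3' : 1 - v3 ≠ 0 := sub_ne_zero.mpr hv3'.symm
  have hc' : c = 16 * v1 * v2 / ((1 + v1) ^ 2 * (1 + v2) ^ 2) := by
    rw [hc, hz1, hz2]; field_simp; ring
  have hb' : b = 16 * v1 * v2 * (1 - v3) ^ 2 / ((1 + v1) ^ 2 * (1 + v2) ^ 2 * (1 + v3) ^ 2) := by
    rw [hb, hc', hz3]; field_simp
  have ha' : a = 16 * Γreal / ((1 + v1) ^ 2 * (1 + v2) ^ 2 * (1 + v3) ^ 2) := by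
    rw [ha, hΓ, hz1, hz2, hz3]; field_simp; ring
  have hΓΔ : ((Γreal : ℂ) + Δ) * (Γreal - Δ) = 4 * v1 ^ 2 * v2 ^ 2 * (1 - v3) ^ 2 * (1 + v3) ^ 2 := by
    rw [hΓ]
    push_cast at hΔ ⊢
    linear_combination -hΔ
  have hc0 : (c : ℂ) ≠ 0 := by
    rw [hc', Complex.ofReal_ne_zero]; positivity
  have hb0 : (b : ℂ) ≠ 0 := by
    rw [hb', Complex.ofReal_ne_zero]; positivity
  have k1 : (1 : ℂ) + v1 ≠ 0 := mod_cast h1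
  have k2 : (1 : ℂ) + v2 ≠ 0 := mod_cast h2
  have k3 : (1 : ℂ) + v3 ≠ 0 := mod_cast h3
  have k3' : (1 : ℂ) - v3 ≠ 0 := mod_cast h3'
  have l1 : (v1 : ℂ) ≠ 0 := mod_cast hv1.ne'
  have l2 : (v2 : ℂ) ≠ 0 := mod_cast hv2.ne'
  have hsum12 : ζ1 + ζ2 = (a : ℂ) / b := by
    rw [hζ1, hζ2, ha', hb']; push_cast; field_simp; ring
  have hprod12 : ζ1 * ζ2 = (c : ℂ) / b := by
    rw [hζ1, hζ2, div_mul_div_comm, hΓΔ, hc', hb']; push_cast; field_simp; ring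
  have hsum34 : ζ3 + ζ4 = (a : ℂ) / c := by
    rw [hζ3, hζ4, ha', hc']; push_cast; field_simp; ring
  have hprod34 : ζ3 * ζ4 = (b : ℂ) / c := by
    rw [hζ3, hζ4, div_mul_div_comm, hΓΔ, hc', hb']; push_cast; field_simp; ring
  exact ⟨quadratic_eq_of_vieta hb0 hsum12 hprod12, quadratic_eq_of_vieta hc0 hsum34 hprod34,
    hsum12, hprod12, hsum34, hprod34⟩
end

section
/- With residues (ρ_1,ρ_2,ρ_3,ρ_4) = (1/2, 1/2, −1/2, −1/2) attached to the singularities (ζ_1,ζ_2,ζ_3,ζ_4), the numerator spectral polynomial 2V(ζ) := Σ_{j=1}^{4} ρ_j·Π_{i≠j}(ζ−ζ_i) has degree at most 2 and equals −m_1ζ² + m_2ζ − m_3, where m_1 = m_3 = 2v_3((v_1²+v_2²)v_3²−v_1²v_2²−1)/(v_1v_2(1−v_3²)²) and m_2 = −8v_3(1+v_3²)/(1−v_3²)²; in particular the leading coefficient m_0 = ρ_1+ρ_2+ρ_3+ρ_4 vanishes. -/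
/-- With residues `(ρ₁,ρ₂,ρ₃,ρ₄) = (1/2,1/2,−1/2,−1/2)` attached to the singularities
`(ζ₁,ζ₂,ζ₃,ζ₄)`, the numerator spectral polynomial
`2V(ζ) = Σ_j ρ_j Π_{i≠j}(ζ−ζ_i)` equals `−m₁ζ² + m₂ζ − m₃` (degree at most `2`,
i.e. the leading coefficient `m₀ = ρ₁+ρ₂+ρ₃+ρ₄` vanishes). -/
theorem stmt11 (v1 v2 v3 : ℝ) (hv12 : v1*v2 ≠ 0) (hv3 : v3 ≠ 1) (hv3' : v3 ≠ -1)
    (Γreal : ℝ)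
    (hΓ : Γreal = 1 + v1^2*v2^2 - (v1^2+v2^2)*v3^2)
    (Δ : ℂ)
    (hΔ : Δ^2 = ((1+v1*v2-v1*v3-v2*v3) * (1-v1*v2-v1*v3+v2*v3)
      * (1-v1*v2+v1*v3-v2*v3) * (1+v1*v2+v1*v3+v2*v3) : ℝ))
    (ζ1 ζ2 ζ3 ζ4 : ℂ)
    (hζ1 : ζ1 = ((Γreal:ℂ)+Δ)/(2*v1*v2*(1-v3)^2))
    (hζ2 : ζ2 = ((Γreal:ℂ)-Δ)/(2*v1*v2*(1-v3)^2))
    (hζ3 : ζ3 = ((Γreal:ℂ)+Δ)/(2*v1*v2*(1+v3)^2))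
    (hζ4 : ζ4 = ((Γreal:ℂ)-Δ)/(2*v1*v2*(1+v3)^2))
    (m1 m2 m3 : ℝ)
    (hm1 : m1 = 2*v3*((v1^2+v2^2)*v3^2 - v1^2*v2^2 - 1) / (v1*v2*(1-v3^2)^2))
    (hm3 : m3 = m1)
    (hm2 : m2 = -8*v3*(1+v3^2)/(1-v3^2)^2) :
    (∀ ζ : ℂ,
      (1/2)*(ζ-ζ2)*(ζ-ζ3)*(ζ-ζ4) + (1/2)*(ζ-ζ1)*(ζ-ζ3)*(ζ-ζ4)
        - (1/2)*(ζ-ζ1)*(ζ-ζ2)*(ζ-ζ4) - (1/2)*(ζ-ζ1)*(ζ-ζ2)*(ζ-ζ3)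
      = -(m1:ℂ)*ζ^2 + (m2:ℂ)*ζ - (m3:ℂ)) ∧
    (1/2 : ℝ) + 1/2 + (-(1/2)) + (-(1/2)) = 0 := by
  have h1 : (v1 : ℂ) ≠ 0 := by exact_mod_cast left_ne_zero_of_mul hv12
  have h2 : (v2 : ℂ) ≠ 0 := by exact_mod_cast right_ne_zero_of_mul hv12
  have hA : (1 - v3 : ℂ) ≠ 0 := by exact_mod_cast sub_ne_zero.mpr hv3.symm
  have hB : (1 + v3 : ℂ) ≠ 0 := by
    have : 1 + v3 ≠ 0 := fun h => hv3' (by linarith)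
    exact_mod_cast this
  have hAB : (1 - v3 ^ 2 : ℂ) = (1 - v3) * (1 + v3) := by ring
  have hΓ' : (Γreal : ℂ) = 1 + v1^2*v2^2 - (v1^2+v2^2)*v3^2 := by rw [hΓ]; push_cast; ring
  have hdisc : ((Γreal : ℂ) + Δ) * (Γreal - Δ) = 4 * v1^2 * v2^2 * ((1 - v3)^2 * (1 + v3)^2) := by
    have : ((Γreal : ℂ) + Δ) * (Γreal - Δ) = (Γreal : ℂ)^2 - Δ^2 := by ring
    rw [this, hΔ, hΓ']
    push_cast
    ring
  have sum12 : ζ1 + ζ2 = Γreal / (v1 * v2 * (1 - v3)^2) := by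
    rw [hζ1, hζ2]; field_simp; ring
  have sum34 : ζ3 + ζ4 = Γreal / (v1 * v2 * (1 + v3)^2) := by
    rw [hζ3, hζ4]; field_simp; ring
  have prod12 : ζ1 * ζ2 = (1 + v3)^2 / (1 - v3)^2 := by
    rw [hζ1, hζ2, div_mul_div_comm, hdisc]; field_simp; ring
  have prod34 : ζ3 * ζ4 = (1 - v3)^2 / (1 + v3)^2 := by
    rw [hζ3, hζ4, div_mul_div_comm, hdisc]; field_simp; ring
  have hm1' : (m1 : ℂ) = -2 * v3 * Γreal / (v1 * v2 * ((1 - v3) * (1 + v3))^2) := by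
    rw [hm1, hΓ', ← hAB]; push_cast; ring
  have hm2' : (m2 : ℂ) = -8 * v3 * (1 + v3^2) / ((1 - v3) * (1 + v3))^2 := by
    rw [hm2, ← hAB]; push_cast; ring
  refine ⟨fun ζ => ?_, by norm_num⟩
  have key : (1/2)*(ζ-ζ2)*(ζ-ζ3)*(ζ-ζ4) + (1/2)*(ζ-ζ1)*(ζ-ζ3)*(ζ-ζ4)
        - (1/2)*(ζ-ζ1)*(ζ-ζ2)*(ζ-ζ4) - (1/2)*(ζ-ζ1)*(ζ-ζ2)*(ζ-ζ3)
      = (1/2) * ((ζ1 + ζ2) - (ζ3 + ζ4)) * ζ^2 + (ζ3 * ζ4 - ζ1 * ζ2) * ζ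
        + (1/2) * ((ζ3 + ζ4) * (ζ1 * ζ2) - (ζ1 + ζ2) * (ζ3 * ζ4)) := by ring
  rw [key, hm3, sum12, sum34, prod12, prod34, hm1', hm2']
  field_simp
  ring
end

section
/- At the disorder point, i.e. when −v_1v_2+v_1v_3+v_2v_3 = 1, the discriminant Δ² vanishes, so Δ = 0 and the four singularities coalesce pairwise: ζ_1 = ζ_2 = Γ/(2v_1v_2(1−v_3)²) and ζ_3 = ζ_4 = Γ/(2v_1v_2(1+v_3)²); moreover ζ_1ζ_3 = 1 and z_3²·ζ_1² = 1, so the merged singularities have moduli |z_3|^{−1} and |z_3| respectively. -/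
/-- At the disorder point `−v₁v₂+v₁v₃+v₂v₃ = 1` the discriminant vanishes and the four
singularities of the triangular-lattice weight coalesce pairwise, the merged
singularities having moduli `|z₃|⁻¹` and `|z₃|`. -/
theorem stmt15 (v1 v2 v3 : ℝ) (hv12 : v1*v2 ≠ 0) (hv3 : v3 ≠ 1) (hv3' : v3 ≠ -1)
    (Γreal z3 : ℝ)
    (hΓ : Γreal = 1 + v1^2*v2^2 - (v1^2+v2^2)*v3^2)
    (hz3 : z3 = (1-v3)/(1+v3))
    (Δ : ℝ)
    (hΔ : Δ^2 = (1+v1*v2-v1*v3-v2*v3) * (1-v1*v2-v1*v3+v2*v3)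
      * (1-v1*v2+v1*v3-v2*v3) * (1+v1*v2+v1*v3+v2*v3))
    (ζ1 ζ2 ζ3 ζ4 : ℝ)
    (hζ1 : ζ1 = (Γreal+Δ)/(2*v1*v2*(1-v3)^2))
    (hζ2 : ζ2 = (Γreal-Δ)/(2*v1*v2*(1-v3)^2))
    (hζ3 : ζ3 = (Γreal+Δ)/(2*v1*v2*(1+v3)^2))
    (hζ4 : ζ4 = (Γreal-Δ)/(2*v1*v2*(1+v3)^2))
    (hdis : -(v1*v2) + v1*v3 + v2*v3 = 1) :
    Δ = 0 ∧
    ζ1 = ζ2 ∧ ζ1 = Γreal/(2*v1*v2*(1-v3)^2) ∧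
    ζ3 = ζ4 ∧ ζ3 = Γreal/(2*v1*v2*(1+v3)^2) ∧
    ζ1 * ζ3 = 1 ∧ z3^2 * ζ1^2 = 1 ∧
    |ζ1| = |z3|⁻¹ ∧ |ζ3| = |z3| := by
  have hv1 : v1 ≠ 0 := left_ne_zero_of_mul hv12
  have hv2 : v2 ≠ 0 := right_ne_zero_of_mul hv12
  have hm : 1 - v3 ≠ 0 := sub_ne_zero.mpr hv3.symm
  have hp : 1 + v3 ≠ 0 := fun h => hv3' (by linarith)
  have hΔ0 : Δ = 0 := by
    have hfac : 1 + v1*v2 - v1*v3 - v2*v3 = 0 := by linarith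
    rw [hfac] at hΔ
    exact pow_eq_zero_iff two_ne_zero |>.mp (by rw [hΔ]; ring)
  have hΓ' : Γreal = -(2*v1*v2*(1-v3)*(1+v3)) := by
    rw [hΓ]
    linear_combination (-(1 + v1*v2) - (v1+v2)*v3) * hdis
  subst hΔ0
  rw [add_zero] at hζ1 hζ3
  rw [sub_zero] at hζ2 hζ4
  have h1 : ζ1 = -z3⁻¹ := by
    rw [hζ1, hΓ', hz3]
    field_simp
  have h3 : ζ3 = -z3 := by
    rw [hζ3, hΓ', hz3]
    field_simp
  have hz : z3 ≠ 0 := hz3 ▸ div_ne_zero hm hp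
  refine ⟨rfl, hζ1.trans hζ2.symm, hζ1, hζ3.trans hζ4.symm, hζ3, ?_, ?_, ?_, ?_⟩
  · rw [h1, h3]
    field_simp
  · rw [h1]
    field_simp
  · rw [h1, abs_neg, abs_inv]
  · rw [h3, abs_neg]
end

section
/- At the Curie point (v_1v_2+v_1v_3+v_2v_3 = 1) or at the Néel point (v_1v_2−v_1v_3−v_2v_3 = 1) one has (1+v_3²)²Δ² = 4v_3²Γ², and consequently the singularities coalesce pairwise on the unit circle: either ζ_2 = ζ_3 with ζ_2² = 1, or ζ_1 = ζ_4 with ζ_1² = 1. -/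
/-- At the Curie point or the Néel point of the anisotropic triangular-lattice Ising
model one has `(1+v₃²)²Δ² = 4v₃²Γ²`, and the singularities coalesce pairwise on the
unit circle: either `ζ₂ = ζ₃` with `ζ₂² = 1`, or `ζ₁ = ζ₄` with `ζ₁² = 1`. -/
theorem stmt16 (v1 v2 v3 : ℝ) (hv12 : v1*v2 ≠ 0) (hv3 : v3 ≠ 1) (hv3' : v3 ≠ -1)
    (Γreal : ℝ)
    (hΓ : Γreal = 1 + v1^2*v2^2 - (v1^2+v2^2)*v3^2)
    (Δ : ℝ)
    (hΔ : Δ^2 = (1+v1*v2-v1*v3-v2*v3) * (1-v1*v2-v1*v3+v2*v3)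
      * (1-v1*v2+v1*v3-v2*v3) * (1+v1*v2+v1*v3+v2*v3))
    (ζ1 ζ2 ζ3 ζ4 : ℝ)
    (hζ1 : ζ1 = (Γreal+Δ)/(2*v1*v2*(1-v3)^2))
    (hζ2 : ζ2 = (Γreal-Δ)/(2*v1*v2*(1-v3)^2))
    (hζ3 : ζ3 = (Γreal+Δ)/(2*v1*v2*(1+v3)^2))
    (hζ4 : ζ4 = (Γreal-Δ)/(2*v1*v2*(1+v3)^2))
    (hcrit : v1*v2 + v1*v3 + v2*v3 = 1 ∨ v1*v2 - v1*v3 - v2*v3 = 1) :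
    (1+v3^2)^2 * Δ^2 = 4*v3^2*Γreal^2 ∧
    ((ζ2 = ζ3 ∧ ζ2^2 = 1) ∨ (ζ1 = ζ4 ∧ ζ1^2 = 1)) := by
  have hsq : ((v1 + v2)*v3)^2 = (1 - v1*v2)^2 := by
    rcases hcrit with h | h
    · rw [show (v1 + v2)*v3 = 1 - v1*v2 by linarith]
    · rw [show (v1 + v2)*v3 = -(1 - v1*v2) by linarith, neg_sq]
  have hG : Γreal = 2*(v1*v2)*(1 + v3^2) := by
    rw [hΓ]
    linear_combination -hsq
  have hD : Δ^2 = (4*(v1*v2)*v3)^2 := by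
    have hprod₁ : (1+v1*v2-v1*v3-v2*v3) * (1+v1*v2+v1*v3+v2*v3) = 4*(v1*v2) := by
      linear_combination -hsq
    have hprod₂ : (1-v1*v2-v1*v3+v2*v3) * (1-v1*v2+v1*v3-v2*v3) = 4*(v1*v2)*v3^2 := by
      linear_combination -hsq
    rw [hΔ]
    linear_combination (1-v1*v2-v1*v3+v2*v3) * (1-v1*v2+v1*v3-v2*v3) * hprod₁
      + 4*(v1*v2) * hprod₂
  have hm : 2*v1*v2*(1-v3)^2 ≠ 0 := by
    rw [mul_assoc 2]
    exact mul_ne_zero (mul_ne_zero two_ne_zero hv12) (pow_ne_zero 2 (sub_ne_zero.mpr hv3.symm))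
  have hp : 2*v1*v2*(1+v3)^2 ≠ 0 := by
    rw [mul_assoc 2]
    refine mul_ne_zero (mul_ne_zero two_ne_zero hv12) (pow_ne_zero 2 fun h => hv3' ?_)
    linarith
  refine ⟨by rw [hD, hG]; ring, ?_⟩
  rcases sq_eq_sq_iff_eq_or_eq_neg.mp hD with h | h
  · have h2 : ζ2 = 1 := by
      rw [hζ2, div_eq_one_iff_eq hm, hG, h]
      ring
    have h3 : ζ3 = 1 := by
      rw [hζ3, div_eq_one_iff_eq hp, hG, h]
      ring
    exact Or.inl ⟨h2.trans h3.symm, by rw [h2, one_pow]⟩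
  · have h1 : ζ1 = 1 := by
      rw [hζ1, div_eq_one_iff_eq hm, hG, h]
      ring
    have h4 : ζ4 = 1 := by
      rw [hζ4, div_eq_one_iff_eq hp, hG, h]
      ring
    exact Or.inr ⟨h1.trans h4.symm, by rw [h1, one_pow]⟩
end
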